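/- arXiv:1903.07369 — 3 statements merged into one kernel-verified Lean document; each statement's English description precedes it below -/
import Mathlib

section
/- Let θ ∈ (0, π), y₁ ∈ ℝ, and 0 < s₀ ≤ l, and define d(s, y₁) = √((s − y₁ cos θ)² + y₁² sin² θ). Then ∫_{s₀}^{l} (s · |y₁| · sin² θ) · d(s, y₁)^{−7/2} ds ≤ 2 · (sin θ)^{−3/2} · s₀^{−1/2}. -/
/-- For `θ ∈ (0, π)`, `0 < s₀ ≤ l` and `d(s,y₁) = √((s − y₁ cos θ)² + y₁² sin²θ)`,
`∫_{s₀}^{l} (s |y₁| sin²θ) d(s,y₁)^{−7/2} ds ≤ 2 (sin θ)^{−3/2} s₀^{−1/2}`. -/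
theorem stmt_9 (θ y₁ s₀ l : ℝ) (hθ : θ ∈ Set.Ioo 0 Real.pi) (hs₀ : 0 < s₀) (hl : s₀ ≤ l) :
    (∫ s in s₀..l,
        s * |y₁| * Real.sin θ ^ 2 *
          Real.sqrt ((s - y₁ * Real.cos θ) ^ 2 + y₁ ^ 2 * Real.sin θ ^ 2) ^ (-(7 / 2 : ℝ)))
      ≤ 2 * Real.sin θ ^ (-(3 / 2 : ℝ)) * s₀ ^ (-(1 / 2 : ℝ)) := by
  have hsin : 0 < Real.sin θ := Real.sin_pos_of_pos_of_lt_pi hθ.1 hθ.2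
  have hD : ∀ s : ℝ, 0 < s → s * Real.sin θ ≤
      Real.sqrt ((s - y₁ * Real.cos θ) ^ 2 + y₁ ^ 2 * Real.sin θ ^ 2) := by
    intro s hs
    apply Real.le_sqrt_of_sq_le
    have h := Real.sin_sq_add_cos_sq θ
    have h2 : (s - y₁ * Real.cos θ) ^ 2 + y₁ ^ 2 * Real.sin θ ^ 2 - (s * Real.sin θ) ^ 2
        = (s * Real.cos θ - y₁) ^ 2 := by
      have : Real.sin θ ^ 2 = 1 - Real.cos θ ^ 2 := by linarith
      rw [mul_pow, this]; ring
    nlinarith [sq_nonneg (s * Real.cos θ - y₁)]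
  have hD2 : ∀ s : ℝ, |y₁| * Real.sin θ ≤
      Real.sqrt ((s - y₁ * Real.cos θ) ^ 2 + y₁ ^ 2 * Real.sin θ ^ 2) := by
    intro s
    apply Real.le_sqrt_of_sq_le
    rw [mul_pow, sq_abs]
    nlinarith [sq_nonneg (s - y₁ * Real.cos θ)]
  have hpos : ∀ s ∈ Set.uIcc s₀ l, 0 < s := by
    intro s hs
    rw [Set.uIcc_of_le hl] at hs
    exact lt_of_lt_of_le hs₀ hs.1
  have key : ∀ s ∈ Set.Icc s₀ l, s * |y₁| * Real.sin θ ^ 2 *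
          Real.sqrt ((s - y₁ * Real.cos θ) ^ 2 + y₁ ^ 2 * Real.sin θ ^ 2) ^ (-(7 / 2 : ℝ))
      ≤ Real.sin θ ^ (-(3 / 2 : ℝ)) * s ^ (-(3 / 2 : ℝ)) := by
    intro s hs
    have hs0 : 0 < s := lt_of_lt_of_le hs₀ hs.1
    have h1 := hD s hs0
    have h2 := hD2 s
    set D := Real.sqrt ((s - y₁ * Real.cos θ) ^ 2 + y₁ ^ 2 * Real.sin θ ^ 2) with hDdef
    have hp : 0 < s * Real.sin θ := by positivity
    have hDp : 0 < D := lt_of_lt_of_le hp h1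
    calc s * |y₁| * Real.sin θ ^ 2 * D ^ (-(7 / 2 : ℝ))
        = (s * Real.sin θ) * (|y₁| * Real.sin θ) * D ^ (-(7 / 2 : ℝ)) := by ring
      _ ≤ D * D * D ^ (-(7 / 2 : ℝ)) := by gcongr
      _ = D ^ (-(3 / 2 : ℝ)) := by
          rw [← sq, ← Real.rpow_natCast, ← Real.rpow_add hDp]; norm_num
      _ ≤ (s * Real.sin θ) ^ (-(3 / 2 : ℝ)) :=
          Real.rpow_le_rpow_of_nonpos hp h1 (by norm_num)
      _ = _ := by rw [Real.mul_rpow hs0.le hsin.le, mul_comm]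
  have h0 : (0 : ℝ) ∉ Set.uIcc s₀ l := fun h => lt_irrefl _ (hpos 0 h)
  calc _ ≤ ∫ s in s₀..l, Real.sin θ ^ (-(3 / 2 : ℝ)) * s ^ (-(3 / 2 : ℝ)) := by
        apply intervalIntegral.integral_mono_on hl _ _ key
        · apply ContinuousOn.intervalIntegrable
          apply ContinuousOn.mul (by fun_prop)
          apply ContinuousOn.rpow_const (by fun_prop)
          intro s hs
          left
          exact (lt_of_lt_of_le (mul_pos (hpos s hs) hsin) (hD s (hpos s hs))).ne'
        · exact (intervalIntegral.intervalIntegrable_rpow (Or.inr h0)).const_mul _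
    _ ≤ _ := by
        rw [intervalIntegral.integral_const_mul,
          integral_rpow (Or.inr ⟨by norm_num, h0⟩)]
        have e : (-(3 / 2 : ℝ)) + 1 = -(1 / 2) := by norm_num
        rw [e]
        have hl' : 0 ≤ l ^ (-(1 / 2 : ℝ)) := Real.rpow_nonneg (hs₀.le.trans hl) _
        have := Real.rpow_nonneg hsin.le (-(3 / 2 : ℝ))
        nlinarith [mul_nonneg this hl']
end

section
/- Let θ ∈ (0, π/2), y₁ ∈ ℝ with 0 < |y₁|, and t ∈ ℝ with t ≥ |y₁|. Define D(t) = √((t − y₁ cos θ)² + y₁² sin² θ). Then (|y₁| · |t² − y₁²|) / (D(t)³ · √(t − y₁ cos θ)) ≤ 1 / (sin³ θ · √|y₁| · sin(θ/2)). -/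
/-- Pointwise bound (eq:est:I1:2): for `θ ∈ (0, π/2)`, `0 < |y₁|`, `t ≥ |y₁|`, and
`D(t) = √((t − y₁ cos θ)² + y₁² sin²θ)`,
`|y₁| |t² − y₁²| / (D(t)³ √(t − y₁ cos θ)) ≤ 1 / (sin³θ √|y₁| sin(θ/2))`. -/
theorem stmt_14 (θ y₁ t : ℝ) (hθ : θ ∈ Set.Ioo 0 (Real.pi / 2)) (hy : 0 < |y₁|)
    (ht : |y₁| ≤ t) :
    |y₁| * |t ^ 2 - y₁ ^ 2| /
        (Real.sqrt ((t - y₁ * Real.cos θ) ^ 2 + y₁ ^ 2 * Real.sin θ ^ 2) ^ 3 *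
          Real.sqrt (t - y₁ * Real.cos θ))
      ≤ 1 / (Real.sin θ ^ 3 * Real.sqrt |y₁| * Real.sin (θ / 2)) := by
  obtain ⟨h0, h1⟩ := hθ
  have hpi := Real.pi_pos
  have hs : 0 < Real.sin θ := Real.sin_pos_of_pos_of_lt_pi h0 (by linarith)
  have hh : 0 < Real.sin (θ / 2) := Real.sin_pos_of_pos_of_lt_pi (by linarith) (by linarith)
  have hc : 0 < Real.cos θ := Real.cos_pos_of_mem_Ioo ⟨by linarith, h1⟩
  have hcs : Real.cos θ = 1 - 2 * Real.sin (θ / 2) ^ 2 := by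
    have e1 := Real.cos_two_mul (θ / 2)
    have e2 := Real.sin_sq_add_cos_sq (θ / 2)
    rw [show 2 * (θ / 2) = θ by ring] at e1
    linarith
  have hsc := Real.sin_sq_add_cos_sq θ
  have htp : 0 < t := lt_of_lt_of_le hy ht
  have hR : Real.sqrt |y₁| * Real.sin (θ / 2) ≤ Real.sqrt (t - y₁ * Real.cos θ) := by
    apply Real.le_sqrt_of_sq_le
    rw [mul_pow, Real.sq_sqrt hy.le]
    have a1 : y₁ * Real.cos θ ≤ |y₁| * Real.cos θ :=
      mul_le_mul_of_nonneg_right (le_abs_self _) hc.le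
    have a2 : |y₁| * Real.cos θ = |y₁| - 2 * (|y₁| * Real.sin (θ / 2) ^ 2) := by
      rw [hcs]; ring
    have a3 : 0 ≤ |y₁| * Real.sin (θ / 2) ^ 2 := by positivity
    linarith
  have hD1 : t * Real.sin θ ≤
      Real.sqrt ((t - y₁ * Real.cos θ) ^ 2 + y₁ ^ 2 * Real.sin θ ^ 2) := by
    apply Real.le_sqrt_of_sq_le
    have e : (t - y₁ * Real.cos θ) ^ 2 + y₁ ^ 2 * Real.sin θ ^ 2
        = (t * Real.sin θ) ^ 2 + (t * Real.cos θ - y₁) ^ 2 := by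
      linear_combination (y₁ ^ 2 - t ^ 2) * hsc
    rw [e]
    linarith [sq_nonneg (t * Real.cos θ - y₁)]
  have hD2 : |y₁| * Real.sin θ ≤
      Real.sqrt ((t - y₁ * Real.cos θ) ^ 2 + y₁ ^ 2 * Real.sin θ ^ 2) := by
    apply Real.le_sqrt_of_sq_le
    rw [mul_pow, sq_abs]
    linarith [sq_nonneg (t - y₁ * Real.cos θ)]
  have hN : |t ^ 2 - y₁ ^ 2| ≤ t ^ 2 := by
    have a : y₁ ^ 2 ≤ t ^ 2 := by
      rw [← sq_abs y₁]; exact pow_le_pow_left₀ hy.le ht 2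
    rw [abs_of_nonneg (by linarith)]
    linarith [sq_nonneg y₁]
  generalize Real.sqrt ((t - y₁ * Real.cos θ) ^ 2 + y₁ ^ 2 * Real.sin θ ^ 2) = D at *
  generalize Real.sqrt (t - y₁ * Real.cos θ) = R at *
  have hq : 0 < Real.sqrt |y₁| := Real.sqrt_pos.2 hy
  have hDp : 0 < D := lt_of_lt_of_le (by positivity) hD1
  have hRp : 0 < R := lt_of_lt_of_le (by positivity) hR
  rw [div_le_div_iff₀ (by positivity) (by positivity)]
  calc |y₁| * |t ^ 2 - y₁ ^ 2| * (Real.sin θ ^ 3 * Real.sqrt |y₁| * Real.sin (θ / 2))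
      ≤ |y₁| * t ^ 2 * (Real.sin θ ^ 3 * Real.sqrt |y₁| * Real.sin (θ / 2)) := by gcongr
    _ = (t * Real.sin θ) ^ 2 * (|y₁| * Real.sin θ) * (Real.sqrt |y₁| * Real.sin (θ / 2)) := by
        ring
    _ ≤ D ^ 2 * D * R := by gcongr
    _ = 1 * (D ^ 3 * R) := by ring
end

section
/- Let k > 0, θ ∈ (0, π), y₁ ∈ ℝ with y₁ ≠ 0, and 0 < s₀ ≤ l. Define d(s, y₁) = √((s − y₁ cos θ)² + y₁² sin² θ), t(s) = s + d(s, y₁), and D(t) = √((t − y₁ cos θ)² + y₁² sin² θ). Then ∫_{s₀}^{l} (s y₁ / d(s, y₁)^{5/2}) · exp(i k (d(s, y₁) + s)) ds = √2 · ∫_{t(s₀)}^{t(l)} (y₁ (t² − y₁²) · exp(i k t)) / (D(t)³ · (t − y₁ cos θ)^{1/2}) dt. -/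
theorem aux_alg (y s d D u : ℝ) (hd : 0 < d) (hu : 0 < u) (hD : 0 < D) (hD2 : D ^ 2 = 2 * u * d) :
    s * y / d ^ ((5 : ℝ) / 2) =
      Real.sqrt 2 * (u / d * (y * (2 * u * s) / (D ^ 3 * Real.sqrt u))) := by
  have h1 : D = Real.sqrt 2 * Real.sqrt u * Real.sqrt d := by
    rw [← Real.sqrt_mul (by norm_num), ← Real.sqrt_mul (by positivity), ← hD2,
      Real.sqrt_sq hD.le]
  have h2 : d ^ ((5 : ℝ) / 2) = Real.sqrt d ^ 5 := by
    rw [Real.sqrt_eq_rpow, ← Real.rpow_natCast, ← Real.rpow_mul hd.le]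
    norm_num
  have hp := Real.sqrt_pos.2 hd
  have hq := Real.sqrt_pos.2 hu
  have e1 := Real.sq_sqrt hd.le
  have e2 := Real.sq_sqrt hu.le
  have e3 := Real.sq_sqrt (show (0:ℝ) ≤ 2 by norm_num)
  have h3 : (0:ℝ) < Real.sqrt 2 := by positivity
  rw [h2, h1]
  generalize Real.sqrt d = p at *
  generalize Real.sqrt u = q at *
  generalize Real.sqrt 2 = w at *
  subst e1 e2
  rw [← e3]
  field_simp

/-- Change of variables `t = s + d(s,y₁)` (estimate (eq:est:I1:1)): with
`d(s,y₁) = √((s − y₁ cos θ)² + y₁² sin²θ)`, `D(t) = √((t − y₁ cos θ)² + y₁² sin²θ)`,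
for `k > 0`, `θ ∈ (0,π)`, `y₁ ≠ 0`, `0 < s₀ ≤ l`:
`∫_{s₀}^{l} (s y₁ / d^{5/2}) e^{ik(d+s)} ds
  = √2 ∫_{t(s₀)}^{t(l)} y₁(t² − y₁²) e^{ikt} / (D(t)³ (t − y₁ cos θ)^{1/2}) dt`. -/
theorem stmt_17 (k θ y₁ s₀ l : ℝ) (hk : 0 < k) (hθ : θ ∈ Set.Ioo 0 Real.pi)
    (hy : y₁ ≠ 0) (hs₀ : 0 < s₀) (hl : s₀ ≤ l) :
    (∫ s in s₀..l,
        ((s * y₁ /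
            Real.sqrt ((s - y₁ * Real.cos θ) ^ 2 + y₁ ^ 2 * Real.sin θ ^ 2) ^ ((5 : ℝ) / 2) : ℝ) : ℂ) *
          Complex.exp (Complex.I * (k : ℂ) *
            ((Real.sqrt ((s - y₁ * Real.cos θ) ^ 2 + y₁ ^ 2 * Real.sin θ ^ 2) + s : ℝ) : ℂ)))
      = (Real.sqrt 2 : ℂ) *
          ∫ t in (s₀ + Real.sqrt ((s₀ - y₁ * Real.cos θ) ^ 2 + y₁ ^ 2 * Real.sin θ ^ 2))..(l +
              Real.sqrt ((l - y₁ * Real.cos θ) ^ 2 + y₁ ^ 2 * Real.sin θ ^ 2)),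
            ((y₁ * (t ^ 2 - y₁ ^ 2) : ℝ) : ℂ) * Complex.exp (Complex.I * (k : ℂ) * (t : ℂ)) /
              ((Real.sqrt ((t - y₁ * Real.cos θ) ^ 2 + y₁ ^ 2 * Real.sin θ ^ 2) ^ 3 *
                  Real.sqrt (t - y₁ * Real.cos θ) : ℝ) : ℂ) := by
  set c := y₁ * Real.cos θ with hc
  have ha : 0 < y₁ ^ 2 * Real.sin θ ^ 2 := by
    have := Real.sin_pos_of_pos_of_lt_pi hθ.1 hθ.2
    positivity
  have hca : c ^ 2 + y₁ ^ 2 * Real.sin θ ^ 2 = y₁ ^ 2 := by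
    rw [hc]; linear_combination y₁ ^ 2 * Real.sin_sq_add_cos_sq θ
  generalize y₁ ^ 2 * Real.sin θ ^ 2 = a at *
  clear_value c
  have hpos : ∀ s : ℝ, 0 < (s - c) ^ 2 + a := fun s => by positivity
  have hdpos : ∀ s : ℝ, 0 < Real.sqrt ((s - c) ^ 2 + a) := fun s => Real.sqrt_pos.2 (hpos s)
  have hdsq : ∀ s : ℝ, Real.sqrt ((s - c) ^ 2 + a) ^ 2 = (s - c) ^ 2 + a :=
    fun s => Real.sq_sqrt (hpos s).le
  have hu : ∀ s : ℝ, 0 < s + Real.sqrt ((s - c) ^ 2 + a) - c := fun s => by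
    have : -(s - c) < Real.sqrt ((s - c) ^ 2 + a) := by
      apply Real.lt_sqrt_of_sq_lt
      rw [neg_sq]; linarith
    linarith
  have hder : ∀ s : ℝ, HasDerivAt (fun s => s + Real.sqrt ((s - c) ^ 2 + a))
      ((s + Real.sqrt ((s - c) ^ 2 + a) - c) / Real.sqrt ((s - c) ^ 2 + a)) s := fun s => by
    have h1 : HasDerivAt (fun s : ℝ => (s - c) ^ 2 + a) (2 * (s - c)) s := by
      simpa using (((hasDerivAt_id s).sub_const c).pow 2).add_const a
    have h2 := (hasDerivAt_id s).add (h1.sqrt (hpos s).ne')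
    refine h2.congr_deriv ?_
    have := (hdpos s).ne'
    field_simp
    ring
  have hcont : Continuous fun s => (s + Real.sqrt ((s - c) ^ 2 + a) - c) / Real.sqrt ((s - c) ^ 2 + a) :=
    Continuous.div (by fun_prop) (by fun_prop) fun s => (hdpos s).ne'
  have key := intervalIntegral.integral_comp_smul_deriv' (a := s₀) (b := l)
    (f := fun s => s + Real.sqrt ((s - c) ^ 2 + a))
    (f' := fun s => (s + Real.sqrt ((s - c) ^ 2 + a) - c) / Real.sqrt ((s - c) ^ 2 + a))
    (g := fun t : ℝ => ((y₁ * (t ^ 2 - y₁ ^ 2) : ℝ) : ℂ) * Complex.exp (Complex.I * (k : ℂ) * (t : ℂ)) /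
              ((Real.sqrt ((t - c) ^ 2 + a) ^ 3 * Real.sqrt (t - c) : ℝ) : ℂ))
    (fun s _ => hder s) hcont.continuousOn (by
      apply ContinuousOn.div
      · fun_prop
      · fun_prop
      · rintro _ ⟨s, -, rfl⟩
        have h1 := hdpos (s + Real.sqrt ((s - c) ^ 2 + a))
        have h2 := Real.sqrt_pos.2 (hu s)
        exact_mod_cast (by positivity))
  rw [← key, ← intervalIntegral.integral_const_mul]
  apply intervalIntegral.integral_congr
  intro s _
  have hs := hdsq s
  have hD := hdsq (s + Real.sqrt ((s - c) ^ 2 + a))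
  have hDp := hdpos (s + Real.sqrt ((s - c) ^ 2 + a))
  have alg := aux_alg y₁ s _ _ _ (hdpos s) (hu s) hDp (by rw [hD]; linear_combination (-1) * hs)
  simp only [Function.comp, Complex.real_smul]
  rw [alg]
  have e : (s + Real.sqrt ((s - c) ^ 2 + a)) ^ 2 - y₁ ^ 2 =
      2 * (s + Real.sqrt ((s - c) ^ 2 + a) - c) * s := by
    linear_combination hs + hca
  rw [e, add_comm (Real.sqrt ((s - c) ^ 2 + a)) s]
  push_cast
  ring
end
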